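/- Let n ≥ 2 and α > 0. Every even kernel K ∈ L∞(S^{n−1}) (i.e. K(−w) = K(w)), extended to ℝⁿ∖{0} as a 0-homogeneous function, is (n−1, α)-distance-exact; moreover, when α = 1 the constant c_E in the distance-exactness relation can be taken independent of the hyperplane E. -/

import Mathlib

open MeasureTheory Metric Set Filter
open scoped Topology ENNReal NNReal

noncomputable section

abbrev ES (n : ℕ) := EuclideanSpace ℝ (Fin n)

/-- The regularized "R" function `R_{K,μ,α}` with dimension parameter `d`. -/
def RK {n : ℕ} (d α : ℝ) (K : ES n → ℝ) (μ : Measure (ES n)) (x : ES n) : ℝ :=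
  ∫ y, K (x - y) / ‖x - y‖ ^ (d + α) ∂μ

/-- The regularized distance `D_{K,μ,α} = R_{K,μ,α}^{-1/α}`. -/
def DK {n : ℕ} (d α : ℝ) (K : ES n → ℝ) (μ : Measure (ES n)) (x : ES n) : ℝ :=
  RK d α K μ x ^ (-α⁻¹)

/-- `d`-dimensional Hausdorff measure restricted to a subspace. -/
def planeMeasure {n : ℕ} (d : ℕ) (E : Submodule ℝ (ES n)) : Measure (ES n) :=
  (μH[(d : ℝ)]).restrict (E : Set (ES n))

/-- `K` is `(d,α)`-distance-exact. -/
def DistExact (n d : ℕ) (α : ℝ) (K : ES n → ℝ) : Prop :=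
  ∀ E : Submodule ℝ (ES n), Module.finrank ℝ ↥E = d →
    ∃ c : ℝ, ∀ x ∉ E, DK (d : ℝ) α K (planeMeasure d E) x = c * infDist x (E : Set (ES n))

/-- `K` is `(d,α)`-distance-orthogonal. -/
def DistOrth (n d : ℕ) (α : ℝ) (K : ES n → ℝ) : Prop :=
  ∀ E : Submodule ℝ (ES n), Module.finrank ℝ ↥E = d →
    ∀ x ∉ E, RK (d : ℝ) α K (planeMeasure d E) x = 0

/-- `K` is a distance-standard kernel. -/
def DistStandard {n : ℕ} (K : ES n → ℝ) : Prop :=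
  ContDiffOn ℝ 2 K {0}ᶜ ∧
  (∀ m : ℕ, m ≤ 2 → ∃ C : ℝ, ∀ x : ES n, x ≠ 0 →
      ‖iteratedFDerivWithin ℝ m K {0}ᶜ x‖ * ‖x‖ ^ m ≤ C) ∧
  ∃ c > 0, ∀ x : ES n, x ≠ 0 → c ≤ K x

/-- The square function `F_{K,μ,α}` relative to the set `E`. -/
def FK {n : ℕ} (d α : ℝ) (K : ES n → ℝ) (μ : Measure (ES n)) (E : Set (ES n)) (x : ES n) : ℝ :=
  infDist x E * ‖gradient (fun y => ‖gradient (DK d α K μ) y‖ ^ 2) x‖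

/-- `D_{K,μ,α}` satisfies the usual square function estimate (USFE) outside `E`. -/
def SatisfiesUSFE {n : ℕ} (d α : ℝ) (K : ES n → ℝ) (μ : Measure (ES n)) (E : Set (ES n)) : Prop :=
  ∃ C : ℝ, ∀ Q ∈ E, ∀ r > 0,
    (∫ x in ball Q r ∩ Eᶜ, (FK d α K μ E x) ^ 2 * infDist x E ^ (d - (n : ℝ))) ≤ C * r ^ d

/-- The support of a measure on a metric space. -/
def msupp {X : Type*} [PseudoMetricSpace X] [MeasurableSpace X] (μ : Measure X) : Set X :=
  {x | ∀ r > 0, 0 < μ (ball x r)}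

/-- `μ` is `d`-Ahlfors regular with constant `C`. -/
def IsAhlfors {n : ℕ} (d : ℝ) (μ : Measure (ES n)) (C : ℝ) : Prop :=
  1 ≤ C ∧ ∀ Q ∈ msupp μ, ∀ R > 0,
    ENNReal.ofReal (C⁻¹ * R ^ d) ≤ μ (ball Q R) ∧ μ (ball Q R) ≤ ENNReal.ofReal (C * R ^ d)

/-- A non-tangential cone of aperture `η` and radius `R` at `Q`. -/
def NTcone {n : ℕ} (E : Set (ES n)) (Q : ES n) (R η : ℝ) : Set (ES n) :=
  {x | x ∉ E ∧ dist x Q < R ∧ η * dist x Q ≤ infDist x E}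

/-- `f` has non-tangential limit `L` at `Q` with aperture `η`. -/
def HasNTLimit {n : ℕ} (E : Set (ES n)) (f : ES n → ℝ) (Q : ES n) (η L : ℝ) : Prop :=
  ∀ ε > 0, ∃ R > 0, ∀ x ∈ NTcone E Q R η, |f x - L| < ε

/-- A set `E ⊆ ℝⁿ` is `d`-rectifiable. -/
def RectSet (n d : ℕ) (E : Set (ES n)) : Prop :=
  ∃ f : ℕ → (EuclideanSpace ℝ (Fin d) → ES n),
    (∀ i, ∃ L : ℝ≥0, LipschitzWith L (f i)) ∧
    μH[(d : ℝ)] (E \ ⋃ i, Set.range (f i)) = 0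

/-- A measure `μ` is `d`-rectifiable. -/
def RectMeasure (n d : ℕ) (μ : Measure (ES n)) : Prop :=
  μ ≪ μH[(d : ℝ)] ∧ ∃ S : Set (ES n), MeasurableSet S ∧ RectSet n d S ∧ μ Sᶜ = 0

/-- A set `E ⊆ ℝⁿ` is `d`-uniformly rectifiable (the Lipschitz images condition). -/
def UnifRect (n d : ℕ) (E : Set (ES n)) : Prop :=
  ∃ (M : ℝ≥0) (θ : ℝ), 0 < θ ∧ ∀ Q ∈ E, ∀ R > 0,
    ∃ f : EuclideanSpace ℝ (Fin d) → ES n, LipschitzOnWith M f (ball 0 R) ∧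
      ENNReal.ofReal (θ * R ^ d) ≤ μH[(d : ℝ)] (E ∩ ball Q R ∩ f '' (ball 0 R))

end

section HyperplaneCoordinates

variable {V W : Type*}
  [NormedAddCommGroup V] [InnerProductSpace ℝ V]
  [NormedAddCommGroup W] [InnerProductSpace ℝ W]
  {L : V →ₗᵢ[ℝ] W} {e : W}

open Module

lemma norm_sq_isometry_add_smul (he : ‖e‖ = 1) (hL : ∀ z, inner ℝ (L z) e = 0) (z : V) (t : ℝ) :
    ‖L z + t • e‖ ^ 2 = ‖z‖ ^ 2 + t ^ 2 := by
  rw [norm_add_sq_real, inner_smul_right, hL, norm_smul, he, L.norm_map, mul_pow]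
  simp

lemma one_le_norm_add_isometry (he : ‖e‖ = 1) (hL : ∀ z, inner ℝ (L z) e = 0) (z : V) :
    1 ≤ ‖e + L z‖ := by
  have h := norm_sq_isometry_add_smul he hL z 1
  rw [one_smul, add_comm] at h
  nlinarith [norm_nonneg (e + L z), sq_nonneg ‖z‖]

lemma isometry_add_smul_injective (he : ‖e‖ = 1) (hL : ∀ z, inner ℝ (L z) e = 0) :
    Function.Injective fun p : V × ℝ => L p.1 + p.2 • e := by
  rintro ⟨z, t⟩ ⟨z', t'⟩ h
  have h0 : L (z - z') + (t - t') • e = 0 := by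
    rw [← sub_eq_zero.mpr h, map_sub, sub_smul, add_sub_add_comm]
  have h1 := norm_sq_isometry_add_smul he hL (z - z') (t - t')
  rw [h0, norm_zero] at h1
  have h2 : ‖z - z'‖ = 0 := by
    nlinarith [sq_nonneg (t - t'), sq_nonneg ‖z - z'‖, norm_nonneg (z - z')]
  have h3 : t - t' = 0 := by nlinarith [sq_nonneg (t - t'), sq_nonneg ‖z - z'‖]
  exact Prod.ext (sub_eq_zero.mp (norm_eq_zero.mp h2)) (sub_eq_zero.mp h3)

lemma injOn_central_projection (he : ‖e‖ = 1) (hL : ∀ z, inner ℝ (L z) e = 0) :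
    InjOn (fun p : V × ℝ => (p.2 / ‖e + L p.1‖) • (e + L p.1)) {p | p.2 ≠ 0} := by
  rintro ⟨z, s⟩ hs ⟨z', s'⟩ - h
  have hpos := zero_lt_one.trans_le (one_le_norm_add_isometry he hL z)
  have hinj := isometry_add_smul_injective he hL
    (a₁ := ((s / ‖e + L z‖) • z, s / ‖e + L z‖)) (a₂ := ((s' / ‖e + L z'‖) • z', s' / ‖e + L z'‖))
    (by simpa [smul_add, add_comm] using h)
  obtain ⟨h1, h2⟩ := Prod.ext_iff.mp hinj
  dsimp only at h1 h2
  rw [← h2] at h1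
  obtain rfl := smul_right_injective V (div_ne_zero (show s ≠ 0 from hs) hpos.ne') h1
  rw [div_left_inj' hpos.ne'] at h2
  rw [h2]

variable [FiniteDimensional ℝ V] [MeasurableSpace V] [BorelSpace V]
  [FiniteDimensional ℝ W] [MeasurableSpace W] [BorelSpace W]

lemma measurePreserving_isometry_add_smul (he : ‖e‖ = 1) (hL : ∀ z, inner ℝ (L z) e = 0)
    (hfin : finrank ℝ W = finrank ℝ V + 1) :
    MeasurePreserving (fun p : V × ℝ => L p.1 + p.2 • e) := by
  let T : WithLp 2 (V × ℝ) →ₗᵢ[ℝ] W :=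
    { toLinearMap := (L.toLinearMap.coprod (LinearMap.toSpanSingleton ℝ W e)).comp
        (WithLp.linearEquiv 2 ℝ (V × ℝ)).toLinearMap
      norm_map' := fun p => by
        rw [← sq_eq_sq₀ (norm_nonneg _) (norm_nonneg _), WithLp.prod_norm_sq_eq_of_L2,
          Real.norm_eq_abs, sq_abs]
        exact norm_sq_isometry_add_smul he hL p.fst p.snd }
  have hT : finrank ℝ (WithLp 2 (V × ℝ)) = finrank ℝ W := by
    rw [(WithLp.linearEquiv 2 ℝ (V × ℝ)).finrank_eq, hfin]
    simp
  exact (T.toLinearIsometryEquiv hT).measurePreserving.comp (WithLp.volume_preserving_toLp V ℝ)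

lemma lintegral_eq_abs_pow_mul_lintegral_smul {f : V → ℝ≥0∞} (hf : Measurable f) {r : ℝ}
    (hr : r ≠ 0) :
    ∫⁻ x, f x = ENNReal.ofReal (|r| ^ finrank ℝ V) * ∫⁻ x, f (r • x) := by
  rw [← lintegral_map hf (measurable_const_smul r), Measure.map_addHaar_smul _ hr,
    lintegral_smul_measure, smul_eq_mul, ← mul_assoc, ← ENNReal.ofReal_mul (by positivity),
    abs_inv, abs_pow, mul_inv_cancel₀ (by positivity), ENNReal.ofReal_one, one_mul]

/-- Change of variables for central projection from the hyperplane `e + range L`, where `s` is the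
signed distance to the origin. -/
lemma lintegral_central_projection (he : ‖e‖ = 1) (hL : ∀ z, inner ℝ (L z) e = 0)
    (hfin : finrank ℝ W = finrank ℝ V + 1) {F : W → ℝ≥0∞} (hF : Measurable F) :
    ∫⁻ p : V × ℝ, ENNReal.ofReal (|p.2| ^ finrank ℝ V / ‖e + L p.1‖ ^ finrank ℝ W) *
      F ((p.2 / ‖e + L p.1‖) • (e + L p.1)) = ∫⁻ x, F x := by
  have hLm : Measurable L := L.continuous.measurable
  have hscale : ∀ᵐ t : ℝ, ∫⁻ z : V, F (L z + t • e) =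
      ∫⁻ z : V, ENNReal.ofReal (|t| ^ finrank ℝ V) * F (t • (e + L z)) := by
    filter_upwards [Measure.ae_ne volume (0 : ℝ)] with t ht
    rw [lintegral_eq_abs_pow_mul_lintegral_smul (by fun_prop) ht, lintegral_const_mul _ (by fun_prop)]
    simp only [map_smul, smul_add, add_comm]
  rw [← (measurePreserving_isometry_add_smul he hL hfin).lintegral_comp hF, Measure.volume_eq_prod,
    lintegral_prod_symm' (fun p : V × ℝ => F (L p.1 + p.2 • e)) (by fun_prop), lintegral_congr_ae hscale,
    lintegral_lintegral_swap (by fun_prop), lintegral_prod _ (by fun_prop)]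
  refine lintegral_congr fun z => ?_
  have hpos : 0 < ‖e + L z‖ := zero_lt_one.trans_le (one_le_norm_add_isometry he hL z)
  rw [lintegral_eq_abs_pow_mul_lintegral_smul
      (f := fun t : ℝ => ENNReal.ofReal (|t| ^ finrank ℝ V) * F (t • (e + L z)))
      (by fun_prop) (inv_ne_zero hpos.ne'),
    ← lintegral_const_mul _ (by fun_prop)]
  refine lintegral_congr fun s => ?_
  rw [← mul_assoc, ← ENNReal.ofReal_mul (by positivity), smul_eq_mul, inv_mul_eq_div, abs_div,
    abs_inv, abs_of_pos hpos, finrank_self, hfin, div_pow]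
  congr 2
  field_simp
  ring

/-- No measurability of `f` is required. -/
lemma integral_central_projection (he : ‖e‖ = 1) (hL : ∀ z, inner ℝ (L z) e = 0)
    (hfin : finrank ℝ W = finrank ℝ V + 1) (f : W → ℝ) :
    ∫ p : V × ℝ, (|p.2| ^ finrank ℝ V / ‖e + L p.1‖ ^ finrank ℝ W) *
      f ((p.2 / ‖e + L p.1‖) • (e + L p.1)) = ∫ x, f x := by
  have hLm : Measurable L := L.continuous.measurable
  set Φ : V × ℝ → W := fun p => (p.2 / ‖e + L p.1‖) • (e + L p.1) with hΦ
  set ρ : V × ℝ → ℝ := fun p => |p.2| ^ finrank ℝ V / ‖e + L p.1‖ ^ finrank ℝ W with hρ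
  have hΦm : Measurable Φ := by fun_prop
  have hρm : Measurable ρ := by fun_prop
  have hρ0 : ∀ p, 0 ≤ ρ p := fun p => by positivity
  set μ : Measure (V × ℝ) := volume.withDensity fun p => ENNReal.ofReal (ρ p) with hμ
  set S : Set (V × ℝ) := {p | p.2 ≠ 0} with hS
  have hSm : MeasurableSet S := (measurableSet_eq_fun measurable_snd measurable_const).compl
  have hSae : ∀ᵐ p ∂μ, p ∈ S := by
    refine (withDensity_absolutelyContinuous _ _).ae_le ?_
    exact Measure.quasiMeasurePreserving_snd.ae (Measure.ae_ne volume (0 : ℝ))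
  have hμS : μ.restrict S = μ := Measure.restrict_eq_self_of_ae_mem hSae
  have hmap : μ.map Φ = volume := by
    refine Measure.ext fun A hA => ?_
    rw [← lintegral_indicator_one hA, ← lintegral_indicator_one hA,
      lintegral_map (measurable_one.indicator hA) hΦm,
      ← lintegral_central_projection he hL hfin (measurable_one.indicator hA)]
    exact lintegral_withDensity_eq_lintegral_mul _ (ENNReal.measurable_ofReal.comp hρm)
      ((measurable_one.indicator hA).comp hΦm)
  have hemb : MeasurableEmbedding (S.domRestrict Φ) := by
    refine ContinuousOn.measurableEmbedding hSm (Continuous.continuousOn ?_)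
      (injOn_central_projection he hL)
    have hLc := L.continuous
    refine Continuous.smul (continuous_snd.div (by fun_prop) fun p => ?_) (by fun_prop)
    exact (zero_lt_one.trans_le (one_le_norm_add_isometry he hL p.1)).ne'
  have hmap' : (μ.comap ((↑) : S → V × ℝ)).map (S.domRestrict Φ) = volume := by
    rw [← hmap]
    conv_rhs => rw [← hμS, ← map_comap_subtype_coe hSm, Measure.map_map hΦm measurable_subtype_coe]
    rfl
  rw [← hmap', hemb.integral_map]
  simp only [Set.domRestrict_apply]
  rw [integral_subtype_comap hSm fun p => f (Φ p), hμS, hμ,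
    integral_withDensity_eq_integral_toReal_smul (by fun_prop) (by simp)]
  simp only [ENNReal.toReal_ofReal (hρ0 _), smul_eq_mul]
  rfl

end HyperplaneCoordinates

lemma exists_hyperplane_coordinates {m : ℕ} {E : Submodule ℝ (ES (m + 1))}
    (hE : Module.finrank ℝ E = m) :
    ∃ (L : ES m →ₗᵢ[ℝ] ES (m + 1)) (e : ES (m + 1)), ‖e‖ = 1 ∧ (∀ z, inner ℝ (L z) e = 0) ∧
      range L = (E : Set (ES (m + 1))) ∧ ∀ x, ∃ (z : ES m) (t : ℝ), x = L z + t • e := by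
  let R : ES m ≃ₗᵢ[ℝ] E := ((stdOrthonormalBasis ℝ E).reindex (finCongr hE)).repr.symm
  have hEperp : Module.finrank ℝ Eᗮ = 1 := by
    have h := E.finrank_add_finrank_orthogonal
    rw [hE, finrank_euclideanSpace_fin] at h
    omega
  obtain ⟨v, hv0, hv⟩ := finrank_eq_one_iff'.mp hEperp
  have hv0' : ‖(v : ES (m + 1))‖ ≠ 0 := by simpa using hv0
  refine ⟨E.subtypeₗᵢ.comp R.toLinearIsometry, ‖(v : ES (m + 1))‖⁻¹ • (v : ES (m + 1)),
    ?_, fun z => ?_, ?_, fun x => ?_⟩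
  · rw [norm_smul, norm_inv, norm_norm, inv_mul_cancel₀ hv0']
  · rw [inner_smul_right]
    simp [Submodule.inner_right_of_mem_orthogonal (R z).2 v.2]
  · ext x
    constructor
    · rintro ⟨z, rfl⟩
      exact (R z).2
    · intro hx
      exact ⟨R.symm ⟨x, hx⟩, by simp⟩
  · obtain ⟨y, hy, w, hw, rfl⟩ := E.exists_add_mem_mem_orthogonal x
    obtain ⟨c, hc⟩ := hv ⟨w, hw⟩
    refine ⟨R.symm ⟨y, hy⟩, c * ‖(v : ES (m + 1))‖, ?_⟩
    have hc' : c • (v : ES (m + 1)) = w := congrArg Subtype.val hc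
    rw [smul_smul, mul_assoc, mul_inv_cancel₀ hv0', mul_one, hc']
    simp

lemma infDist_isometry_add_smul {V W : Type*} [NormedAddCommGroup V] [InnerProductSpace ℝ V]
    [NormedAddCommGroup W] [InnerProductSpace ℝ W] {L : V →ₗᵢ[ℝ] W} {e : W} (he : ‖e‖ = 1)
    (hL : ∀ z, inner ℝ (L z) e = 0) (z : V) (t : ℝ) :
    infDist (L z + t • e) (range L) = |t| := by
  refine le_antisymm ?_ ((le_infDist (range_nonempty L)).mpr ?_)
  · refine (infDist_le_dist_of_mem (mem_range_self z)).trans_eq ?_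
    simp [dist_eq_norm, norm_smul, he]
  · rintro _ ⟨z', rfl⟩
    have h := norm_sq_isometry_add_smul he hL (z - z') t
    rw [map_sub, ← add_sub_right_comm] at h
    rw [dist_eq_norm, ← abs_norm, ← sq_le_sq, h]
    exact le_add_of_nonneg_left (sq_nonneg _)

/-- The ratio of the `m`-dimensional Hausdorff measure on `ℝᵐ` to Lebesgue measure. -/
noncomputable def hausdorffRatio (m : ℕ) : ℝ≥0 :=
  (μH[(m : ℝ)] : Measure (ES m)).addHaarScalarFactor volume

lemma hausdorffMeasure_eq_hausdorffRatio_smul (m : ℕ) :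
    (μH[(m : ℝ)] : Measure (ES m)) = hausdorffRatio m • volume := by
  have : (μH[(m : ℝ)] : Measure (ES m)).IsAddHaarMeasure := by
    simpa using isAddHaarMeasure_hausdorffMeasure (E := ES m)
  exact Measure.isAddLeftInvariant_eq_smul _ _

lemma integral_planeMeasure {n m : ℕ} {E : Submodule ℝ (ES n)} {L : ES m →ₗᵢ[ℝ] ES n}
    (hLE : range L = (E : Set (ES n))) (f : ES n → ℝ) :
    ∫ y, f y ∂planeMeasure m E = hausdorffRatio m * ∫ z, f (L z) := by
  rw [planeMeasure, ← hLE, ← L.isometry.map_hausdorffMeasure (Or.inl m.cast_nonneg),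
    L.isometry.isClosedEmbedding.measurableEmbedding.integral_map,
    hausdorffMeasure_eq_hausdorffRatio_smul, integral_smul_nnreal_measure, NNReal.smul_def,
    smul_eq_mul]

lemma kernel_smul_of_even_of_homogeneous {n : ℕ} {K : ES n → ℝ}
    (hhom : ∀ lam : ℝ, 0 < lam → ∀ x : ES n, x ≠ 0 → K (lam • x) = K x)
    (heven : ∀ x : ES n, K (-x) = K x) {t : ℝ} (ht : t ≠ 0) {x : ES n} (hx : x ≠ 0) :
    K (t • x) = K x := by
  rcases ht.lt_or_gt with h | h
  · rw [← heven, ← neg_smul, hhom _ (neg_pos.mpr h) x hx]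
  · exact hhom t h x hx

lemma RK_planeMeasure_isometry_add_smul {n m : ℕ} {α : ℝ} {K : ES n → ℝ}
    (hK : ∀ t : ℝ, t ≠ 0 → ∀ x : ES n, x ≠ 0 → K (t • x) = K x)
    {E : Submodule ℝ (ES n)} {L : ES m →ₗᵢ[ℝ] ES n} {e : ES n} (he : ‖e‖ = 1)
    (hL : ∀ z, inner ℝ (L z) e = 0) (hLE : range L = (E : Set (ES n))) (z₀ : ES m) {t : ℝ}
    (ht : t ≠ 0) :
    RK m α K (planeMeasure m E) (L z₀ + t • e) =
      (hausdorffRatio m * ∫ z, K (e + L z) / ‖e + L z‖ ^ ((m : ℝ) + α)) * |t| ^ (-α) := by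
  have ht' : 0 < |t| := abs_pos.mpr ht
  set f : ES m → ℝ := fun z => K (L z + t • e) / ‖L z + t • e‖ ^ ((m : ℝ) + α) with hf
  have h1 : ∫ z, K (L z₀ + t • e - L z) / ‖L z₀ + t • e - L z‖ ^ ((m : ℝ) + α) = ∫ z, f z := by
    rw [← integral_sub_left_eq_self f volume z₀]
    simp only [hf, map_sub, add_sub_right_comm]
  have h2 : ∀ z, f (t • z) =
      |t| ^ (-((m : ℝ) + α)) * (K (e + L z) / ‖e + L z‖ ^ ((m : ℝ) + α)) := fun z => by
    have h0 : e + L z ≠ 0 :=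
      norm_pos_iff.mp (zero_lt_one.trans_le (one_le_norm_add_isometry he hL z))
    simp only [hf, map_smul, ← smul_add]
    rw [add_comm (L z), hK t ht _ h0, norm_smul, Real.norm_eq_abs,
      Real.mul_rpow (abs_nonneg t) (norm_nonneg _), Real.rpow_neg (abs_nonneg t)]
    ring
  have h3 : ∫ z, f z = |t| ^ m * ∫ z, f (t • z) := by
    rw [Measure.integral_comp_smul, finrank_euclideanSpace_fin, smul_eq_mul, ← mul_assoc, abs_inv,
      abs_pow, mul_inv_cancel₀ (by positivity), one_mul]
  rw [RK, integral_planeMeasure hLE, h1, h3]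
  simp only [h2]
  rw [integral_const_mul, ← mul_assoc (|t| ^ m), ← Real.rpow_natCast, ← Real.rpow_add ht',
    neg_add, add_neg_cancel_left]
  ring

lemma mul_rpow_of_pos_right (a : ℝ) {b : ℝ} (hb : 0 < b) (y : ℝ) :
    (a * b) ^ y = a ^ y * b ^ y := by
  rcases lt_or_ge a 0 with ha | ha
  · rw [Real.rpow_def_of_neg (mul_neg_of_neg_of_pos ha hb), Real.rpow_def_of_neg ha,
      Real.log_mul ha.ne hb.ne', add_mul, Real.exp_add, Real.rpow_def_of_pos hb]
    ring
  · exact Real.mul_rpow ha hb.le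

lemma DK_planeMeasure_eq_mul_infDist {n m : ℕ} {α : ℝ} (hα : 0 < α) {K : ES n → ℝ}
    (hK : ∀ t : ℝ, t ≠ 0 → ∀ x : ES n, x ≠ 0 → K (t • x) = K x)
    {E : Submodule ℝ (ES n)} {L : ES m →ₗᵢ[ℝ] ES n} {e : ES n} (he : ‖e‖ = 1)
    (hL : ∀ z, inner ℝ (L z) e = 0) (hLE : range L = (E : Set (ES n)))
    (hspan : ∀ x, ∃ (z : ES m) (t : ℝ), x = L z + t • e) {x : ES n} (hx : x ∉ E) :
    DK m α K (planeMeasure m E) x =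
      (hausdorffRatio m * ∫ z, K (e + L z) / ‖e + L z‖ ^ ((m : ℝ) + α)) ^ (-α⁻¹) *
        infDist x (E : Set (ES n)) := by
  obtain ⟨z, t, rfl⟩ := hspan x
  have ht : t ≠ 0 := by
    rintro rfl
    refine hx ?_
    rw [zero_smul, add_zero, ← SetLike.mem_coe, ← hLE]
    exact mem_range_self z
  have ht' : 0 < |t| := abs_pos.mpr ht
  rw [DK, RK_planeMeasure_isometry_add_smul hK he hL hLE z ht, ← hLE,
    infDist_isometry_add_smul he hL, mul_rpow_of_pos_right _ (by positivity),
    ← Real.rpow_mul ht'.le, neg_mul_neg, mul_inv_cancel₀ hα.ne', Real.rpow_one]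

lemma integral_abs_pow_unit_ball_pos (m : ℕ) :
    0 < ∫ s : ℝ, (ball (0 : ℝ) 1).indicator (fun s => |s| ^ m) s := by
  rw [integral_indicator measurableSet_ball, Real.ball_eq_Ioo,
    ← integral_Ioc_eq_integral_Ioo, ← intervalIntegral.integral_of_le (by norm_num)]
  refine intervalIntegral.integral_pos (by norm_num) (by fun_prop) (fun _ _ => by positivity)
    ⟨1, by norm_num, by norm_num⟩

lemma integral_kernel_hyperplane {m : ℕ} (hm : m ≠ 0) {K : ES (m + 1) → ℝ}
    (hK : ∀ t : ℝ, t ≠ 0 → ∀ x : ES (m + 1), x ≠ 0 → K (t • x) = K x)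
    {L : ES m →ₗᵢ[ℝ] ES (m + 1)} {e : ES (m + 1)} (he : ‖e‖ = 1)
    (hL : ∀ z, inner ℝ (L z) e = 0) :
    ∫ z, K (e + L z) / ‖e + L z‖ ^ (m + 1) =
      (∫ x in ball (0 : ES (m + 1)) 1, K x) /
        ∫ s : ℝ, (ball (0 : ℝ) 1).indicator (fun s => |s| ^ m) s := by
  rw [eq_div_iff (integral_abs_pow_unit_ball_pos m).ne', ← integral_prod_mul,
    ← integral_indicator measurableSet_ball,
    ← integral_central_projection he hL (by simp) ((ball 0 1).indicator K), Measure.volume_eq_prod]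
  refine integral_congr_ae (Eventually.of_forall ?_)
  rintro ⟨z, s⟩
  have hpos : 0 < ‖e + L z‖ := zero_lt_one.trans_le (one_le_norm_add_isometry he hL z)
  simp only [finrank_euclideanSpace_fin]
  rcases eq_or_ne s 0 with rfl | hs
  · simp [hm]
  have hmem : (s / ‖e + L z‖) • (e + L z) ∈ ball (0 : ES (m + 1)) 1 ↔ s ∈ ball (0 : ℝ) 1 := by
    rw [mem_ball_zero_iff, mem_ball_zero_iff, norm_smul, norm_div, norm_norm,
      div_mul_cancel₀ _ hpos.ne']
  by_cases hs1 : s ∈ ball (0 : ℝ) 1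
  · rw [indicator_of_mem hs1, indicator_of_mem (hmem.mpr hs1),
      hK _ (div_ne_zero hs hpos.ne') _ (norm_pos_iff.mp hpos)]
    ring
  · rw [indicator_of_notMem hs1, indicator_of_notMem (mt hmem.mp hs1), mul_zero, mul_zero]

/-- every bounded even `0`-homogeneous kernel is `(n−1,α)`-distance-exact, and
for `α = 1` the distance-exactness constant can be taken independent of the hyperplane. -/
theorem even_homogeneous_kernels_codim_one_distance_exact
    (n : ℕ) (hn : 2 ≤ n) (α : ℝ) (hα : 0 < α)
    (K : ES n → ℝ) (hKbd : ∃ C : ℝ, ∀ x : ES n, |K x| ≤ C)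
    (hhom : ∀ lam : ℝ, 0 < lam → ∀ x : ES n, x ≠ 0 → K (lam • x) = K x)
    (heven : ∀ x : ES n, K (-x) = K x) :
    DistExact n (n - 1) α K ∧
    (α = 1 → ∃ c : ℝ, ∀ E : Submodule ℝ (ES n), Module.finrank ℝ ↥E = n - 1 →
      ∀ x ∉ E,
        DK ((n - 1 : ℕ) : ℝ) 1 K (planeMeasure (n - 1) E) x
          = c * infDist x (E : Set (ES n))) := by
  obtain ⟨m, rfl⟩ : ∃ m, n = m + 1 := ⟨n - 1, by omega⟩
  have hK : ∀ t : ℝ, t ≠ 0 → ∀ x : ES (m + 1), x ≠ 0 → K (t • x) = K x :=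
    fun t ht x hx => kernel_smul_of_even_of_homogeneous hhom heven ht hx
  rw [Nat.add_sub_cancel]
  refine ⟨fun E hE => ?_, fun _ => ⟨(hausdorffRatio m * ((∫ x in ball (0 : ES (m + 1)) 1, K x) /
    ∫ s : ℝ, (ball (0 : ℝ) 1).indicator (fun s => |s| ^ m) s)) ^ (-(1 : ℝ)⁻¹), fun E hE x hx => ?_⟩⟩
  · obtain ⟨L, e, he, hL, hLE, hspan⟩ := exists_hyperplane_coordinates hE
    exact ⟨_, fun x hx => DK_planeMeasure_eq_mul_infDist hα hK he hL hLE hspan hx⟩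
  · obtain ⟨L, e, he, hL, hLE, hspan⟩ := exists_hyperplane_coordinates hE
    rw [DK_planeMeasure_eq_mul_infDist one_pos hK he hL hLE hspan hx,
      ← integral_kernel_hyperplane (by omega) hK he hL]
    simp only [← Real.rpow_natCast, Nat.cast_add, Nat.cast_one]
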